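/- arXiv:1705.04970 — 5 statements merged into one kernel-verified Lean document; each statement's English description precedes it below -/
import Mathlib

section
/- Let x ∈ {0,1}^n, w ∈ ℝ_{≥0}^m, and let j1 ≠ j2 satisfy x_{j1} = 1 and x_{j2} = 0. Then the increase of the penalized objective caused by simultaneously flipping x_{j1} from 1 to 0 and x_{j2} from 0 to 1 equals Δẑ_{j1,j2}(x,w) = Δẑ_{j1}↓(x,w) + Δẑ_{j2}↑(x,w) − Σ_{i ∈ M_E(x) ∩ S_{j1} ∩ S_{j2}} w_i. -/
open Finset

/-- Number of selected columns covering element `i`: `Σ_{j∈N} a_{ij} x_j`,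
where column `j` corresponds to the subset `S j ⊆ M`. -/
def cover {m n : ℕ} (S : Fin n → Finset (Fin m)) (x : Fin n → ℕ) (i : Fin m) : ℕ :=
  ∑ j, if i ∈ S j then x j else 0

/-- Penalized objective
`ẑ(x,w) = Σ_j c_j x_j + Σ_i w_i · max{b_i − Σ_j a_{ij} x_j, 0}`. -/
noncomputable def zhat {m n : ℕ} (c : Fin n → ℝ) (S : Fin n → Finset (Fin m))
    (b : Fin m → ℕ) (w : Fin m → ℝ) (x : Fin n → ℕ) : ℝ :=
  ∑ j, c j * (x j : ℝ) + ∑ i, w i * max ((b i : ℝ) - (cover S x i : ℝ)) 0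

/-- Flip the `j`-th coordinate of a 0-1 vector. -/
def flipAt {n : ℕ} (x : Fin n → ℕ) (j : Fin n) : Fin n → ℕ :=
  fun j' => if j' = j then 1 - x j' else x j'

theorem sum_flipAt_of_eq_zero {R : Type*} [AddCommMonoid R] {n : ℕ} (f : Fin n → ℕ → R)
    (hf : ∀ j, f j 0 = 0) {x : Fin n → ℕ} {j : Fin n} (hj : x j = 0) :
    ∑ k, f k (flipAt x j k) = ∑ k, f k (x k) + f j 1 := by
  have h : ∀ k, f k (flipAt x j k) = f k (x k) + if k = j then f j 1 else 0 := by
    intro k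
    by_cases hk : k = j
    · subst hk
      simp [flipAt, hj, hf]
    · simp [flipAt, hk]
  simp [h, Finset.sum_add_distrib]

theorem flipAt_flipAt_self {n : ℕ} {x : Fin n → ℕ} {j : Fin n} (hj : x j ≤ 1) :
    flipAt (flipAt x j) j = x := by
  funext k
  by_cases hk : k = j
  · subst hk
    simp only [flipAt, if_true]
    omega
  · simp [flipAt, hk]

theorem cover_flipAt_of_eq_zero {m n : ℕ} (S : Fin n → Finset (Fin m)) {x : Fin n → ℕ}
    {j : Fin n} (hj : x j = 0) (i : Fin m) :
    cover S (flipAt x j) i = cover S x i + if i ∈ S j then 1 else 0 :=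
  sum_flipAt_of_eq_zero (fun k t => if i ∈ S k then t else 0) (by simp) hj

theorem cost_flipAt_of_eq_zero {n : ℕ} (c : Fin n → ℝ) {x : Fin n → ℕ}
    {j : Fin n} (hj : x j = 0) :
    ∑ k, c k * (flipAt x j k : ℝ) = ∑ k, c k * (x k : ℝ) + c j := by
  simpa using sum_flipAt_of_eq_zero (fun k t => c k * (t : ℝ)) (by simp) hj

/-- The second difference of `t ↦ max (b - t) 0` at a natural number is the indicator of `b`. -/
theorem max_sub_second_difference (b k : ℕ) :
    max ((b : ℝ) - k) 0 + max ((b : ℝ) - (k + 1 + 1 : ℕ)) 0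
      = 2 * max ((b : ℝ) - (k + 1 : ℕ)) 0 + if k + 1 = b then 1 else 0 := by
  push_cast
  rcases lt_trichotomy (k + 1) b with h | h | h
  · have h' : (k : ℝ) + 1 + 1 ≤ b := by exact_mod_cast h
    rw [max_eq_left, max_eq_left, max_eq_left, if_neg h.ne] <;> linarith
  · subst h
    simp
  · have h' : (b : ℝ) ≤ k := by exact_mod_cast Nat.lt_succ_iff.mp h
    rw [max_eq_right, max_eq_right, max_eq_right, if_neg h.ne'] <;> linarith

/-- for a 0-1 vector `x` with `x j1 = 1`, `x j2 = 0` (`j1 ≠ j2`)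
and nonnegative penalty weights `w`, the increase of the penalized objective
caused by simultaneously flipping `x_{j1}` (1→0) and `x_{j2}` (0→1) equals
`Δẑ_{j1,j2}(x,w) = Δẑ_{j1}↓(x,w) + Δẑ_{j2}↑(x,w) − Σ_{i ∈ M_E(x) ∩ S_{j1} ∩ S_{j2}} w_i`,
where `M_E(x) = {i : Σ_j a_{ij} x_j = b_i}`. -/
theorem delta_two_flip_formula {m n : ℕ} (c : Fin n → ℝ) (S : Fin n → Finset (Fin m))
    (b : Fin m → ℕ) (w : Fin m → ℝ) (x : Fin n → ℕ)
    (hc : ∀ j, 0 < c j) (hw : ∀ i, 0 ≤ w i) (hx : ∀ j, x j ≤ 1)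
    (j1 j2 : Fin n) (hne : j1 ≠ j2) (hj1 : x j1 = 1) (hj2 : x j2 = 0) :
    zhat c S b w (flipAt (flipAt x j1) j2) - zhat c S b w x
      = (zhat c S b w (flipAt x j1) - zhat c S b w x)
        + (zhat c S b w (flipAt x j2) - zhat c S b w x)
        - ∑ i ∈ (S j1 ∩ S j2).filter (fun i => cover S x i = b i), w i := by
  set y := flipAt x j1 with hy
  have hxy : flipAt y j1 = x := flipAt_flipAt_self (hx j1)
  have hy1 : y j1 = 0 := by simp [hy, flipAt, hj1]
  have hy2 : y j2 = 0 := by simp [hy, flipAt, hne.symm, hj2]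
  have cost_x := cost_flipAt_of_eq_zero c hy1
  have cost_up := cost_flipAt_of_eq_zero c hj2
  have cost_swap := cost_flipAt_of_eq_zero c hy2
  rw [hxy] at cost_x
  have penalty : ∑ i, w i * max ((b i : ℝ) - cover S y i) 0
        + ∑ i, w i * max ((b i : ℝ) - cover S (flipAt x j2) i) 0
      = ∑ i, w i * max ((b i : ℝ) - cover S x i) 0
        + ∑ i, w i * max ((b i : ℝ) - cover S (flipAt y j2) i) 0
        + ∑ i ∈ (S j1 ∩ S j2).filter (fun i => cover S x i = b i), w i := by
    have hfilter : (S j1 ∩ S j2).filter (fun i => cover S x i = b i)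
        = univ.filter (fun i => (i ∈ S j1 ∧ i ∈ S j2) ∧ cover S x i = b i) := by
      ext i
      simp
    rw [hfilter, Finset.sum_filter, ← Finset.sum_add_distrib, ← Finset.sum_add_distrib,
      ← Finset.sum_add_distrib]
    refine Finset.sum_congr rfl fun i _ => ?_
    have hcx := cover_flipAt_of_eq_zero S hy1 i
    rw [hxy] at hcx
    rw [cover_flipAt_of_eq_zero S hj2, cover_flipAt_of_eq_zero S hy2, hcx]
    by_cases h1 : i ∈ S j1 <;> by_cases h2 : i ∈ S j2
    · simp only [h1, h2, if_true, true_and]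
      rw [← mul_add, max_sub_second_difference]
      split_ifs <;> ring
    · simp [h1, h2, add_comm]
    · simp [h1, h2]
    · simp [h1, h2]
  unfold zhat
  linarith
end

section
/- Let x ∈ {0,1}^n, w ∈ ℝ_{≥0}^m, and let j1 ≠ j2 satisfy x_{j1} = x_{j2} = 1. Then Δẑ_{j1,j2}(x,w) = Δẑ_{j1}↓(x,w) + Δẑ_{j2}↓(x,w) + Σ_{i ∈ M_+(x) ∩ S_{j1} ∩ S_{j2}} w_i, where M_+(x) = {i ∈ M : Σ_{j∈N} a_{ij} x_j = b_i + 1}. -/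
open Finset

theorem flipAt_cast_of_eq_one {n : ℕ} {x : Fin n → ℕ} {j : Fin n} (hj : x j = 1) (k : Fin n) :
    (flipAt x j k : ℝ) = (x k : ℝ) - if k = j then 1 else 0 := by
  unfold flipAt
  split_ifs with h
  · subst h
    simp [hj]
  · simp

theorem cover_flipAt_add {m n : ℕ} (S : Fin n → Finset (Fin m)) {x : Fin n → ℕ} {j : Fin n}
    (hj : x j = 1) (i : Fin m) :
    cover S (flipAt x j) i + (if i ∈ S j then 1 else 0) = cover S x i := by
  have key : (if i ∈ S j then 1 else 0) = ∑ k, if k = j then (if i ∈ S j then 1 else 0) else 0 := by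
    simp
  unfold cover
  rw [key, ← Finset.sum_add_distrib]
  refine Finset.sum_congr rfl fun k _ => ?_
  unfold flipAt
  by_cases h : k = j
  · subst h
    by_cases hi : i ∈ S k <;> simp [hi, hj]
  · simp [h]

theorem sum_cost_flipAt {n : ℕ} (c : Fin n → ℝ) {x : Fin n → ℕ} {j : Fin n} (hj : x j = 1) :
    ∑ k, c k * (flipAt x j k : ℝ) = ∑ k, c k * (x k : ℝ) - c j := by
  simp [flipAt_cast_of_eq_one hj, mul_sub, Finset.sum_sub_distrib]

/-- The shortfall `max (b - t) 0` is convex in the coverage `t`, with its only kink at `t = b`. -/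
theorem shortfall_second_difference (b t : ℕ) :
    max ((b : ℝ) - t) 0 + max ((b : ℝ) - (t + 2 : ℕ)) 0
      = 2 * max ((b : ℝ) - (t + 1 : ℕ)) 0 + if t + 2 = b + 1 then 1 else 0 := by
  push_cast
  rcases lt_trichotomy (t + 1) b with h | h | h
  · have h' : (t : ℝ) + 2 ≤ b := by exact_mod_cast h
    rw [max_eq_left (by linarith), max_eq_left (by linarith), max_eq_left (by linarith),
      if_neg (by omega)]
    ring
  · subst h
    norm_num
  · have h' : (b : ℝ) ≤ t := by exact_mod_cast Nat.lt_succ_iff.mp h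
    rw [max_eq_right (by linarith), max_eq_right (by linarith), max_eq_right (by linarith),
      if_neg (by omega)]
    ring

/-- for a 0-1 vector `x` with `x j1 = x j2 = 1` (`j1 ≠ j2`)
and nonnegative penalty weights `w`,
`Δẑ_{j1,j2}(x,w) = Δẑ_{j1}↓(x,w) + Δẑ_{j2}↓(x,w) + Σ_{i ∈ M_+(x) ∩ S_{j1} ∩ S_{j2}} w_i`,
where `M_+(x) = {i : Σ_j a_{ij} x_j = b_i + 1}`. -/
theorem delta_two_flip_both_one {m n : ℕ} (c : Fin n → ℝ) (S : Fin n → Finset (Fin m))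
    (b : Fin m → ℕ) (w : Fin m → ℝ) (x : Fin n → ℕ)
    (hc : ∀ j, 0 < c j) (hw : ∀ i, 0 ≤ w i) (hx : ∀ j, x j ≤ 1)
    (j1 j2 : Fin n) (hne : j1 ≠ j2) (hj1 : x j1 = 1) (hj2 : x j2 = 1) :
    zhat c S b w (flipAt (flipAt x j1) j2) - zhat c S b w x
      = (zhat c S b w (flipAt x j1) - zhat c S b w x)
        + (zhat c S b w (flipAt x j2) - zhat c S b w x)
        + ∑ i ∈ (S j1 ∩ S j2).filter (fun i => cover S x i = b i + 1), w i := by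
  have hj2' : flipAt x j1 j2 = 1 := by simp [flipAt, hne.symm, hj2]
  have hsum : ∑ i ∈ (S j1 ∩ S j2).filter (fun i => cover S x i = b i + 1), w i
      = ∑ i, w i * (if i ∈ S j1 ∧ i ∈ S j2 ∧ cover S x i = b i + 1 then 1 else 0) := by
    simp only [mul_ite, mul_one, mul_zero]
    rw [← Finset.sum_filter]
    refine Finset.sum_congr ?_ fun _ _ => rfl
    ext i
    simp [and_assoc]
  have hpen : ∑ i, w i * max ((b i : ℝ) - (cover S (flipAt (flipAt x j1) j2) i : ℝ)) 0
        + ∑ i, w i * max ((b i : ℝ) - (cover S x i : ℝ)) 0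
      = ∑ i, w i * max ((b i : ℝ) - (cover S (flipAt x j1) i : ℝ)) 0
        + ∑ i, w i * max ((b i : ℝ) - (cover S (flipAt x j2) i : ℝ)) 0
        + ∑ i, w i * (if i ∈ S j1 ∧ i ∈ S j2 ∧ cover S x i = b i + 1 then 1 else 0) := by
    simp only [← Finset.sum_add_distrib, ← mul_add]
    refine Finset.sum_congr rfl fun i _ => ?_
    congr 1
    have e1 := cover_flipAt_add S hj1 i
    have e2 := cover_flipAt_add S hj2 i
    have e3 := cover_flipAt_add S hj2' i
    by_cases h1 : i ∈ S j1 <;> by_cases h2 : i ∈ S j2 <;>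
      simp only [h1, h2, if_true, if_false, add_zero] at e1 e2 e3
    · have key := shortfall_second_difference (b i) (cover S (flipAt (flipAt x j1) j2) i)
      have e4 : cover S (flipAt x j2) i = cover S (flipAt (flipAt x j1) j2) i + 1 := by omega
      have e5 : cover S x i = cover S (flipAt (flipAt x j1) j2) i + 2 := by omega
      rw [e4, e5, ← e3]
      simp only [h1, h2, true_and]
      linarith
    · simp [h2, e2, e3]
    · have e4 : cover S (flipAt (flipAt x j1) j2) i = cover S (flipAt x j2) i := by omega
      rw [e1, e4]
      simp [h1, add_comm]
    · simp [h1, e1, e2, e3]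
  unfold zhat
  rw [sum_cost_flipAt c hj2', sum_cost_flipAt c hj1, sum_cost_flipAt c hj2, hsum]
  linarith
end

section
/- (Lemma 1) Suppose a GUB-feasible solution x ∈ {0,1}^n is locally optimal with respect to the 1-flip neighborhood NB_1(x) under the penalized objective ẑ(·,w). Let j1 ≠ j2 be such that the vector x' obtained from x by flipping both x_{j1} and x_{j2} is GUB-feasible. Then Δẑ_{j1,j2}(x,w) < 0 holds only if x_{j1} ≠ x_{j2}. -/
open Finset

/-- GUB feasibility: at most `d h` columns selected from each block `G h`. -/
def GUBfeasible {n k : ℕ} (G : Fin k → Finset (Fin n)) (d : Fin k → ℕ)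
    (x : Fin n → ℕ) : Prop :=
  ∀ h, ∑ j ∈ G h, x j ≤ d h

theorem flipAt_apply_cast {n : ℕ} {x : Fin n → ℕ} {j : Fin n} (hx : x j ≤ 1) (j' : Fin n) :
    (flipAt x j j' : ℝ) = x j' + if j' = j then 1 - 2 * (x j : ℝ) else 0 := by
  unfold flipAt
  split_ifs with h
  · subst h
    push_cast [Nat.cast_sub hx]
    ring
  · simp

theorem cover_flipAt {m n : ℕ} (S : Fin n → Finset (Fin m)) {x : Fin n → ℕ} {j : Fin n}
    (hx : x j ≤ 1) (i : Fin m) :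
    (cover S (flipAt x j) i : ℝ) =
      cover S x i + if i ∈ S j then 1 - 2 * (x j : ℝ) else 0 := by
  have h : ∀ j', (if i ∈ S j' then (flipAt x j j' : ℝ) else 0) =
      (if i ∈ S j' then (x j' : ℝ) else 0) +
        if j' = j then (if i ∈ S j then 1 - 2 * (x j : ℝ) else 0) else 0 := by
    intro j'
    rw [flipAt_apply_cast hx]
    by_cases hj : j' = j
    · subst hj
      split_ifs <;> simp
    · simp [hj]
  simp only [cover, Nat.cast_sum, Nat.cast_ite, Nat.cast_zero, h, sum_add_distrib,
    sum_ite_eq', mem_univ, if_true]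

theorem cost_flipAt {n : ℕ} (c : Fin n → ℝ) {x : Fin n → ℕ} {j : Fin n} (hx : x j ≤ 1) :
    ∑ j', c j' * (flipAt x j j' : ℝ) = ∑ j', c j' * (x j' : ℝ) + c j * (1 - 2 * (x j : ℝ)) := by
  simp [flipAt_apply_cast hx, mul_add, sum_add_distrib]

theorem max_zero_add_le_of_mul_nonneg {t p q : ℝ} (h : 0 ≤ p * q) :
    max (t - p) 0 + max (t - q) 0 ≤ max (t - (p + q)) 0 + max t 0 := by
  rcases mul_nonneg_iff.mp h with ⟨hp, hq⟩ | ⟨hp, hq⟩ <;>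
  rcases max_cases (t - p) 0 with h1 | h1 <;>
  rcases max_cases (t - q) 0 with h2 | h2 <;>
  rcases max_cases (t - (p + q)) 0 with h3 | h3 <;>
  rcases max_cases t 0 with h4 | h4 <;>
  linarith

/-- Flipping two coordinates with equal values changes the penalized objective by at least the
sum of the changes caused by the single flips. -/
theorem zhat_flipAt_add_le {m n : ℕ} (c : Fin n → ℝ) (S : Fin n → Finset (Fin m))
    (b : Fin m → ℕ) {w : Fin m → ℝ} (hw : ∀ i, 0 ≤ w i) {x : Fin n → ℕ} (hx : ∀ j, x j ≤ 1)
    {j1 j2 : Fin n} (hne : j1 ≠ j2) (heq : x j1 = x j2) :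
    zhat c S b w (flipAt x j1) + zhat c S b w (flipAt x j2) ≤
      zhat c S b w (flipAt (flipAt x j1) j2) + zhat c S b w x := by
  have hval : flipAt x j1 j2 = x j2 := by simp [flipAt, hne.symm]
  have hx' : flipAt x j1 j2 ≤ 1 := hval ▸ hx j2
  have hpen : ∑ i, w i * max ((b i : ℝ) - cover S (flipAt x j1) i) 0 +
      ∑ i, w i * max ((b i : ℝ) - cover S (flipAt x j2) i) 0 ≤
      ∑ i, w i * max ((b i : ℝ) - cover S (flipAt (flipAt x j1) j2) i) 0 +
      ∑ i, w i * max ((b i : ℝ) - cover S x i) 0 := by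
    rw [← sum_add_distrib, ← sum_add_distrib]
    refine sum_le_sum fun i _ => ?_
    rw [← mul_add, ← mul_add]
    refine mul_le_mul_of_nonneg_left ?_ (hw i)
    rw [cover_flipAt S hx', cover_flipAt S (hx j1), cover_flipAt S (hx j2), hval, heq, add_assoc]
    simp only [← sub_sub (b i : ℝ) (cover S x i : ℝ)]
    apply max_zero_add_le_of_mul_nonneg
    split_ifs <;> simp [mul_self_nonneg]
  unfold zhat
  rw [cost_flipAt c hx', cost_flipAt c (hx j1), cost_flipAt c (hx j2), hval]
  linarith

/-- A block containing a coordinate that the double flip raises is not saturated. -/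
theorem sum_lt_of_GUBfeasible_flipAt {n k : ℕ} {G : Fin k → Finset (Fin n)} {d : Fin k → ℕ}
    {x : Fin n → ℕ} {j1 j2 : Fin n} (hne : j1 ≠ j2) (h1 : x j1 = 0) (h2 : x j2 = 0)
    (hfeas : GUBfeasible G d (flipAt (flipAt x j1) j2)) {j : Fin n} (hj : j = j1 ∨ j = j2)
    {h : Fin k} (hjG : j ∈ G h) : ∑ j' ∈ G h, x j' < d h := by
  refine lt_of_lt_of_le (sum_lt_sum (fun j' _ => ?_) ⟨j, hjG, ?_⟩) (hfeas h)
  · unfold flipAt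
    grind
  · unfold flipAt
    grind

/-- Lemma 1: suppose `x` is a GUB-feasible 0-1 solution that is
locally optimal with respect to the 1-flip neighborhood under `ẑ(·,w)`:
(a) flipping any `x_j = 0 → 1` whose block is not saturated does not decrease
`ẑ`, and (b) flipping any `x_j = 1 → 0` does not decrease `ẑ`.  If `j1 ≠ j2`
and the double flip keeps GUB feasibility, then the double flip improves
(`Δẑ_{j1,j2}(x,w) < 0`) only if `x_{j1} ≠ x_{j2}`. -/
theorem lemma1_two_flip_needs_opposite {m n k : ℕ}
    (c : Fin n → ℝ) (S : Fin n → Finset (Fin m)) (b : Fin m → ℕ)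
    (G : Fin k → Finset (Fin n)) (d : Fin k → ℕ) (w : Fin m → ℝ)
    (hc : ∀ j, 0 < c j) (hw : ∀ i, 0 ≤ w i)
    (hpart : ∀ j : Fin n, ∃! h, j ∈ G h) (hdG : ∀ h, d h ≤ (G h).card)
    (x : Fin n → ℕ) (hx : ∀ j, x j ≤ 1) (hfeas : GUBfeasible G d x)
    (hup : ∀ j h, x j = 0 → j ∈ G h → (∑ j' ∈ G h, x j') < d h →
      0 ≤ zhat c S b w (flipAt x j) - zhat c S b w x)
    (hdown : ∀ j, x j = 1 →
      0 ≤ zhat c S b w (flipAt x j) - zhat c S b w x)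
    (j1 j2 : Fin n) (hne : j1 ≠ j2)
    (hfeas' : GUBfeasible G d (flipAt (flipAt x j1) j2))
    (himp : zhat c S b w (flipAt (flipAt x j1) j2) - zhat c S b w x < 0) :
    x j1 ≠ x j2 := by
  intro heq
  have hadd := zhat_flipAt_add_le c S b hw hx hne heq
  suffices h : ∀ j, j = j1 ∨ j = j2 → 0 ≤ zhat c S b w (flipAt x j) - zhat c S b w x by
    linarith [h j1 (.inl rfl), h j2 (.inr rfl)]
  intro j hj
  have hval : x j = x j1 := by
    rcases hj with rfl | rfl
    exacts [rfl, heq.symm]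
  rcases Nat.le_one_iff_eq_zero_or_eq_one.mp (hx j1) with h0 | h1
  · obtain ⟨h, hjG, -⟩ := hpart j
    exact hup j h (hval.trans h0) hjG
      (sum_lt_of_GUBfeasible_flipAt hne h0 (heq ▸ h0) hfeas' hj hjG)
  · exact hdown j (hval.trans h1)
end

section
/- (Lemma 3) Suppose a GUB-feasible solution x ∈ {0,1}^n is locally optimal with respect to the 1-flip neighborhood NB_1(x) under the penalized objective ẑ(·,w), and suppose for a block G_h and indices j1, j2 ∈ G_h with x_{j1} = 1 and x_{j2} = 0 we have Δẑ_{j1,j2}(x,w) < 0, M_E(x) ∩ S_{j1} ∩ S_{j2} = ∅, and Σ_{j∈G_h} x_j = d_h. Let j1* be a minimizer of Δẑ_j↓(x,w) over j ∈ G_h with x_j = 1, and j2* a minimizer of Δẑ_j↑(x,w) over j ∈ G_h with x_j = 0. Then Δẑ_{j1*,j2*}(x,w) < 0. -/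
open Finset

theorem sum_mul_flipAt {n : ℕ} (f : Fin n → ℝ) (x : Fin n → ℕ) (j : Fin n) (hj : x j ≤ 1) :
    ∑ l, f l * (flipAt x j l : ℝ) = ∑ l, f l * (x l : ℝ) + f j * (1 - 2 * (x j : ℝ)) := by
  have key : ∀ l, f l * (flipAt x j l : ℝ)
      = f l * (x l : ℝ) + if l = j then f j * (1 - 2 * (x j : ℝ)) else 0 := by
    intro l
    by_cases hl : l = j
    · subst hl
      simp only [flipAt, if_true, Nat.cast_sub hj]
      push_cast
      ring
    · simp [flipAt, hl]
  simp only [key, Finset.sum_add_distrib, Finset.sum_ite_eq', Finset.mem_univ, if_true]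

theorem cast_cover {m n : ℕ} (S : Fin n → Finset (Fin m)) (x : Fin n → ℕ) (i : Fin m) :
    (cover S x i : ℝ) = ∑ j, (if i ∈ S j then (1 : ℝ) else 0) * (x j : ℝ) := by
  simp [cover]

theorem cast_cover_flipAt {m n : ℕ} (S : Fin n → Finset (Fin m)) (x : Fin n → ℕ) (i : Fin m)
    (j : Fin n) (hj : x j ≤ 1) :
    (cover S (flipAt x j) i : ℝ)
      = cover S x i + (if i ∈ S j then (1 : ℝ) else 0) * (1 - 2 * (x j : ℝ)) := by
  simp only [cast_cover, sum_mul_flipAt (fun l => if i ∈ S l then (1 : ℝ) else 0) x j hj]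

theorem flipAt_of_ne {n : ℕ} (x : Fin n → ℕ) {j l : Fin n} (hl : l ≠ j) :
    flipAt x j l = x l := by
  simp [flipAt, hl]

/-- The defect of additivity of the objective change under a swap is the total weight of the
exactly covered elements shared by the two swapped columns. -/
theorem zhat_swap_add {m n : ℕ} (c : Fin n → ℝ) (S : Fin n → Finset (Fin m))
    (b : Fin m → ℕ) (w : Fin m → ℝ) (x : Fin n → ℕ) (j l : Fin n)
    (hj : x j = 1) (hl : x l = 0) :
    zhat c S b w (flipAt (flipAt x j) l) + zhat c S b w x
        + ∑ i ∈ (S j ∩ S l).filter (fun i => cover S x i = b i), w i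
      = zhat c S b w (flipAt x j) + zhat c S b w (flipAt x l) := by
  have hne : l ≠ j := by
    rintro rfl
    omega
  have hl' : flipAt x j l = 0 := by rw [flipAt_of_ne x hne, hl]
  have hpen : ∀ i,
      w i * max ((b i : ℝ) - (cover S (flipAt (flipAt x j) l) i : ℝ)) 0
        + w i * max ((b i : ℝ) - (cover S x i : ℝ)) 0
        + (if i ∈ S j ∩ S l ∧ cover S x i = b i then w i else 0)
      = w i * max ((b i : ℝ) - (cover S (flipAt x j) i : ℝ)) 0
        + w i * max ((b i : ℝ) - (cover S (flipAt x l) i : ℝ)) 0 := by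
    intro i
    rw [cast_cover_flipAt S (flipAt x j) i l (by omega), cast_cover_flipAt S x i j (by omega),
      cast_cover_flipAt S x i l (by omega), hl', hj, hl]
    by_cases h1 : i ∈ S j <;> by_cases h2 : i ∈ S l <;>
      simp only [h1, h2, Finset.mem_inter, true_and, false_and, and_false, if_true, if_false]
    · rcases lt_trichotomy (cover S x i) (b i) with hlt | heq | hgt
      · have hc : (cover S x i : ℝ) + 1 ≤ b i := by exact_mod_cast hlt
        rw [if_neg hlt.ne, max_eq_left, max_eq_left, max_eq_left, max_eq_left] <;>
          push_cast <;> linarith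
      · rw [if_pos heq, heq]
        norm_num
      · have hc : (b i : ℝ) + 1 ≤ cover S x i := by exact_mod_cast hgt
        rw [if_neg hgt.ne', max_eq_right, max_eq_right, max_eq_right, max_eq_right] <;>
          push_cast <;> linarith
    all_goals
      push_cast
      ring_nf
  have hsum := Finset.sum_congr rfl (fun i (_ : i ∈ (Finset.univ : Finset (Fin m))) => hpen i)
  simp only [Finset.sum_add_distrib] at hsum
  have hfilter : ∑ i ∈ (S j ∩ S l).filter (fun i => cover S x i = b i), w i
      = ∑ i, if i ∈ S j ∩ S l ∧ cover S x i = b i then w i else 0 := by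
    rw [← Finset.sum_filter]
    congr 1
    ext i
    simp
  unfold zhat
  rw [hfilter, sum_mul_flipAt c (flipAt x j) l (by omega), sum_mul_flipAt c x j (by omega),
    sum_mul_flipAt c x l (by omega), hl', hj, hl]
  push_cast
  linarith

/-- Lemma 3: suppose `x` is a GUB-feasible 0-1 solution that is
locally optimal with respect to the 1-flip neighborhood under `ẑ(·,w)`, and
for a block `G h` and `j1, j2 ∈ G h` with `x_{j1} = 1`, `x_{j2} = 0` we have
`Δẑ_{j1,j2}(x,w) < 0`, `M_E(x) ∩ S_{j1} ∩ S_{j2} = ∅`, and `Σ_{j∈G h} x_j = d h`.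
If `j1*` minimizes `Δẑ_j↓(x,w)` over `j ∈ G h` with `x_j = 1` and `j2*`
minimizes `Δẑ_j↑(x,w)` over `j ∈ G h` with `x_j = 0`, then
`Δẑ_{j1*,j2*}(x,w) < 0`. -/
theorem lemma3_best_pair_improves {m n k : ℕ}
    (c : Fin n → ℝ) (S : Fin n → Finset (Fin m)) (b : Fin m → ℕ)
    (G : Fin k → Finset (Fin n)) (d : Fin k → ℕ) (w : Fin m → ℝ)
    (hc : ∀ j, 0 < c j) (hw : ∀ i, 0 ≤ w i)
    (hpart : ∀ j : Fin n, ∃! h, j ∈ G h) (hdG : ∀ h, d h ≤ (G h).card)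
    (x : Fin n → ℕ) (hx : ∀ j, x j ≤ 1) (hfeas : GUBfeasible G d x)
    (hup : ∀ j h, x j = 0 → j ∈ G h → (∑ j' ∈ G h, x j') < d h →
      0 ≤ zhat c S b w (flipAt x j) - zhat c S b w x)
    (hdown : ∀ j, x j = 1 →
      0 ≤ zhat c S b w (flipAt x j) - zhat c S b w x)
    (h : Fin k) (j1 j2 : Fin n) (hj1G : j1 ∈ G h) (hj2G : j2 ∈ G h)
    (hj1 : x j1 = 1) (hj2 : x j2 = 0)
    (himp : zhat c S b w (flipAt (flipAt x j1) j2) - zhat c S b w x < 0)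
    (hME : (S j1 ∩ S j2).filter (fun i => cover S x i = b i) = ∅)
    (hsat : (∑ j ∈ G h, x j) = d h)
    (j1s j2s : Fin n) (hj1sG : j1s ∈ G h) (hj2sG : j2s ∈ G h)
    (hj1s : x j1s = 1) (hj2s : x j2s = 0)
    (hj1smin : ∀ j ∈ G h, x j = 1 →
      zhat c S b w (flipAt x j1s) - zhat c S b w x
        ≤ zhat c S b w (flipAt x j) - zhat c S b w x)
    (hj2smin : ∀ j ∈ G h, x j = 0 →
      zhat c S b w (flipAt x j2s) - zhat c S b w x
        ≤ zhat c S b w (flipAt x j) - zhat c S b w x) :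
    zhat c S b w (flipAt (flipAt x j1s) j2s) - zhat c S b w x < 0 := by
  have hswap := zhat_swap_add c S b w x j1 j2 hj1 hj2
  have hswaps := zhat_swap_add c S b w x j1s j2s hj1s hj2s
  rw [hME, Finset.sum_empty] at hswap
  have hnonneg : 0 ≤ ∑ i ∈ (S j1s ∩ S j2s).filter (fun i => cover S x i = b i), w i :=
    Finset.sum_nonneg fun i _ => hw i
  linarith [hj1smin j1 hj1G hj1, hj2smin j2 hj2G hj2]
end

section
/- (Exactness of the penalty function) Suppose the penalty weights satisfy w_i > Σ_{j∈N} c_j for all i ∈ M, and let x* minimize the penalized objective ẑ(·,w) over all GUB-feasible x ∈ {0,1}^n. Then: (a) if x* violates some multicover constraint (i.e., Σ_{j∈N} a_{ij} x*_j < b_i for some i), then SMCP-GUB has no feasible solution; (b) if SMCP-GUB has a feasible solution, then x* is feasible for SMCP-GUB and z(x*) ≤ z(x) for every feasible solution x of SMCP-GUB. -/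
open Finset

theorem zhat_eq_of_covered {m n : ℕ} (c : Fin n → ℝ) {S : Fin n → Finset (Fin m)}
    {b : Fin m → ℕ} (w : Fin m → ℝ) {x : Fin n → ℕ} (h : ∀ i, b i ≤ cover S x i) :
    zhat c S b w x = ∑ j, c j * (x j : ℝ) := by
  have hzero : ∀ i, w i * max ((b i : ℝ) - (cover S x i : ℝ)) 0 = 0 := fun i => by
    rw [max_eq_right (sub_nonpos.mpr (Nat.cast_le.mpr (h i))), mul_zero]
  simp [zhat, hzero]

/-- Leaving a demand unmet costs at least the corresponding weight. -/
theorem weight_le_zhat_of_cover_lt {m n : ℕ} {c : Fin n → ℝ} {S : Fin n → Finset (Fin m)}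
    {b : Fin m → ℕ} {w : Fin m → ℝ} {x : Fin n → ℕ} (hc : ∀ j, 0 ≤ c j) (hw : ∀ i, 0 ≤ w i)
    {i : Fin m} (hi : cover S x i < b i) : w i ≤ zhat c S b w x := by
  have hshort : (1 : ℝ) ≤ (b i : ℝ) - (cover S x i : ℝ) := by
    have : (cover S x i : ℝ) + 1 ≤ b i := by exact_mod_cast hi
    linarith
  calc
    w i ≤ w i * max ((b i : ℝ) - (cover S x i : ℝ)) 0 :=
      le_mul_of_one_le_right (hw i) (le_max_of_le_left hshort)
    _ ≤ ∑ i, w i * max ((b i : ℝ) - (cover S x i : ℝ)) 0 :=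
      Finset.single_le_sum (f := fun i => w i * max ((b i : ℝ) - (cover S x i : ℝ)) 0)
        (fun i _ => mul_nonneg (hw i) (le_max_right _ _)) (Finset.mem_univ i)
    _ ≤ zhat c S b w x :=
      le_add_of_nonneg_left (Finset.sum_nonneg fun j _ => mul_nonneg (hc j) (Nat.cast_nonneg _))

/-- Exactness of the penalty function: suppose the penalty
weights satisfy `w_i > Σ_{j∈N} c_j` for all `i`, and `x*` minimizes the
penalized objective `ẑ(·,w)` over all GUB-feasible 0-1 vectors.  Then
(a) if `x*` violates some multicover constraint, SMCP-GUB is infeasible, and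
(b) if SMCP-GUB has a feasible solution, `x*` is feasible and optimal for
SMCP-GUB. -/
theorem penalty_exactness {m n k : ℕ}
    (c : Fin n → ℝ) (S : Fin n → Finset (Fin m)) (b : Fin m → ℕ)
    (G : Fin k → Finset (Fin n)) (d : Fin k → ℕ) (w : Fin m → ℝ)
    (hc : ∀ j, 0 < c j)
    (hpart : ∀ j : Fin n, ∃! h, j ∈ G h) (hdG : ∀ h, d h ≤ (G h).card)
    (hw : ∀ i, (∑ j, c j) < w i)
    (xstar : Fin n → ℕ) (hxs : ∀ j, xstar j ≤ 1)
    (hxsfeas : GUBfeasible G d xstar)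
    (hmin : ∀ x : Fin n → ℕ, (∀ j, x j ≤ 1) → GUBfeasible G d x →
      zhat c S b w xstar ≤ zhat c S b w x) :
    ((∃ i, cover S xstar i < b i) →
      ¬ ∃ x : Fin n → ℕ, (∀ j, x j ≤ 1) ∧ GUBfeasible G d x ∧
        ∀ i, b i ≤ cover S x i) ∧
    ((∃ x : Fin n → ℕ, (∀ j, x j ≤ 1) ∧ GUBfeasible G d x ∧
        ∀ i, b i ≤ cover S x i) →
      (∀ i, b i ≤ cover S xstar i) ∧
        ∀ x : Fin n → ℕ, (∀ j, x j ≤ 1) → GUBfeasible G d x →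
          (∀ i, b i ≤ cover S x i) →
          ∑ j, c j * (xstar j : ℝ) ≤ ∑ j, c j * (x j : ℝ)) := by
  have hc0 : ∀ j, 0 ≤ c j := fun j => (hc j).le
  have hw0 : ∀ i, 0 ≤ w i := fun i => (Finset.sum_nonneg fun j _ => hc0 j).trans (hw i).le
  have key : ∀ x : Fin n → ℕ, (∀ j, x j ≤ 1) → GUBfeasible G d x →
      (∀ i, b i ≤ cover S x i) → ∀ i, b i ≤ cover S xstar i := by
    intro x hx hG hcov i
    by_contra! hi
    have hmin' := hmin x hx hG
    rw [zhat_eq_of_covered c w hcov] at hmin'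
    have hcost : ∑ j, c j * (x j : ℝ) ≤ ∑ j, c j :=
      Finset.sum_le_sum fun j _ => mul_le_of_le_one_right (hc0 j) (by exact_mod_cast hx j)
    linarith [hw i, weight_le_zhat_of_cover_lt hc0 hw0 hi]
  constructor
  · rintro ⟨i, hi⟩ ⟨x, hx, hG, hcov⟩
    exact hi.not_ge (key x hx hG hcov i)
  · rintro ⟨x, hx, hG, hcov⟩
    have hstar := key x hx hG hcov
    refine ⟨hstar, fun y hy hyG hycov => ?_⟩
    simpa only [zhat_eq_of_covered c w hstar, zhat_eq_of_covered c w hycov] using hmin y hy hyG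
end
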